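/- Let f : ℂ → ℂ be smooth, n ≥ 0 an integer, and suppose f(e^{iφ} z) = e^{inφ} f(z) for all φ ∈ ℝ and z ∈ ℂ. Then there exists a smooth function h : [0, ∞) → ℂ (smooth as a function of the variable a = r², including one-sided derivatives of all orders at 0) such that f(r e^{iφ}) = e^{inφ} r^n h(r²) for all r ≥ 0 and φ ∈ ℝ. -/

import Mathlib

open Filter Topology intervalIntegral
open scoped ContDiff

section SmoothDivision

variable {E : Type*} [NormedAddCommGroup E] [NormedSpace ℝ E]

theorem hasDerivAt_integral_pow_smul_comp_mul {f : ℝ → E} (hf : ContDiff ℝ ∞ f) (m : ℕ) (x : ℝ) :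
    HasDerivAt (fun x : ℝ => ∫ t in (0 : ℝ)..1, t ^ m • f (x * t))
      (∫ t in (0 : ℝ)..1, t ^ (m + 1) • deriv f (x * t)) x := by
  have hf' : Continuous (deriv f) := hf.continuous_deriv (by simp)
  have hfc : Continuous f := hf.continuous
  have hK : IsCompact (Metric.closedBall x 1 ×ˢ Set.Icc (0 : ℝ) 1) :=
    (isCompact_closedBall x 1).prod isCompact_Icc
  obtain ⟨C, hC⟩ := hK.exists_bound_of_continuousOn
    (f := fun p : ℝ × ℝ => p.2 ^ (m + 1) • deriv f (p.1 * p.2)) (by fun_prop)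
  refine (intervalIntegral.hasDerivAt_integral_of_dominated_loc_of_deriv_le
    (F' := fun x t => t ^ (m + 1) • deriv f (x * t)) (bound := fun _ => C)
    (Metric.closedBall_mem_nhds x one_pos) (Eventually.of_forall fun y => ?_) ?_ ?_ ?_ ?_ ?_).2
  · exact Continuous.aestronglyMeasurable (by fun_prop)
  · exact Continuous.intervalIntegrable (by fun_prop) _ _
  · exact Continuous.aestronglyMeasurable (by fun_prop)
  · refine Eventually.of_forall fun t ht y hy => hC (y, t) ⟨hy, ?_⟩
    rw [Set.uIoc_of_le zero_le_one] at ht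
    exact ⟨ht.1.le, ht.2⟩
  · exact intervalIntegrable_const
  · refine Eventually.of_forall fun t _ y _ => ?_
    have h1 : HasDerivAt f (deriv f (y * t)) (y * t) :=
      (hf.differentiable (by simp) _).hasDerivAt
    have h2 : HasDerivAt (fun y : ℝ => y * t) t y := by
      simpa using (hasDerivAt_id y).mul_const t
    have h3 := (h1.scomp y h2).const_smul (t ^ m)
    rw [smul_smul, ← pow_succ] at h3
    exact h3

theorem contDiff_integral_pow_smul_comp_mul {f : ℝ → E} (hf : ContDiff ℝ ∞ f) (m : ℕ) :
    ContDiff ℝ ∞ (fun x : ℝ => ∫ t in (0 : ℝ)..1, t ^ m • f (x * t)) := by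
  refine contDiff_infty.2 fun N => ?_
  induction N generalizing f m with
  | zero =>
    exact contDiff_zero.2 (continuous_iff_continuousAt.2 fun x =>
      (hasDerivAt_integral_pow_smul_comp_mul hf m x).continuousAt)
  | succ N ih =>
    push_cast
    refine contDiff_succ_iff_deriv.2 ⟨fun x =>
      (hasDerivAt_integral_pow_smul_comp_mul hf m x).differentiableAt, by simp, ?_⟩
    rw [funext fun x => (hasDerivAt_integral_pow_smul_comp_mul hf m x).deriv]
    exact ih (contDiff_infty_iff_deriv.1 hf).2 (m + 1)

/-- **Hadamard's lemma** on the real line. -/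
theorem ContDiff.exists_eq_add_smul [CompleteSpace E] {f : ℝ → E} (hf : ContDiff ℝ ∞ f) :
    ∃ g : ℝ → E, ContDiff ℝ ∞ g ∧ ∀ x, f x = f 0 + x • g x := by
  have hf' : ContDiff ℝ ∞ (deriv f) := (contDiff_infty_iff_deriv.1 hf).2
  refine ⟨_, contDiff_integral_pow_smul_comp_mul hf' 0, fun x => ?_⟩
  have hd : ∀ t : ℝ, HasDerivAt (fun t : ℝ => f (x * t)) (x • deriv f (x * t)) t := fun t =>
    (hf.differentiable (by simp) _).hasDerivAt.scomp t
      (by simpa using (hasDerivAt_id t).const_mul x)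
  have hc : Continuous (deriv f) := hf'.continuous
  have := integral_eq_sub_of_hasDerivAt (a := 0) (b := 1) (fun t _ => hd t)
    (Continuous.intervalIntegrable (by fun_prop) _ _)
  rw [intervalIntegral.integral_smul] at this
  simp [this]

theorem iteratedDeriv_succ_smul_self {g : ℝ → E} (hg : ContDiff ℝ ∞ g) (k : ℕ) (x : ℝ) :
    iteratedDeriv (k + 1) (fun y => y • g y) x =
      x • iteratedDeriv (k + 1) g x + (k + 1 : ℝ) • iteratedDeriv k g x := by
  have hd : ∀ j y, HasDerivAt (iteratedDeriv j g) (iteratedDeriv (j + 1) g y) y := fun j y => by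
    rw [iteratedDeriv_succ]
    exact (hg.differentiable_iteratedDeriv j
      (WithTop.coe_lt_coe.2 (ENat.natCast_lt_top j)) y).hasDerivAt
  induction k generalizing x with
  | zero =>
    have := ((hasDerivAt_id x).smul (hd 0 x)).deriv
    refine Eq.trans (congrFun iteratedDeriv_one x) (this.trans ?_)
    simp [iteratedDeriv_one]
  | succ k ih =>
    rw [iteratedDeriv_succ, funext ih]
    have := (((hasDerivAt_id x).smul (hd (k + 1) x)).add ((hd k x).const_smul (k + 1 : ℝ))).deriv
    refine this.trans ?_
    simp only [id]
    push_cast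
    module

/-- `f` has the formal Taylor series `∑ xʲ • a j` at `0`, with smooth remainders. -/
def HasSmoothTaylorSeries (f : ℝ → E) (a : ℕ → E) : Prop :=
  ∀ k, ∃ g : ℝ → E, ContDiff ℝ ∞ g ∧ ∀ x, f x = ∑ j ∈ Finset.range k, x ^ j • a j + x ^ k • g x

theorem ContDiff.hasSmoothTaylorSeries [CompleteSpace E] {f : ℝ → E} (hf : ContDiff ℝ ∞ f) :
    HasSmoothTaylorSeries f fun j => (j.factorial : ℝ)⁻¹ • iteratedDeriv j f 0 := by
  intro k
  induction k generalizing f with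
  | zero => exact ⟨f, hf, by simp⟩
  | succ k ih =>
    obtain ⟨g, hg, hfg⟩ := hf.exists_eq_add_smul
    obtain ⟨r, hr, hgr⟩ := ih hg
    refine ⟨r, hr, fun x => ?_⟩
    have hcoef : ∀ j, iteratedDeriv (j + 1) f 0 = (j + 1 : ℝ) • iteratedDeriv j g 0 := fun j => by
      rw [funext hfg, iteratedDeriv_const_add (Nat.succ_pos j), iteratedDeriv_succ_smul_self hg,
        zero_smul, zero_add]
    rw [hfg x, hgr x, Finset.sum_range_succ']
    simp only [hcoef, smul_add, Finset.smul_sum, smul_smul, pow_zero, Nat.factorial_zero,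
      iteratedDeriv_zero, Nat.cast_one, inv_one, one_smul, ← pow_succ']
    rw [add_comm (f 0), add_right_comm]
    congr 2
    refine Finset.sum_congr rfl fun j _ => ?_
    congr 1
    rw [Nat.factorial_succ]
    push_cast
    field_simp
    ring

/-- `f` is smooth and vanishes to infinite order at `0`. -/
def IsFlatAtZero (f : ℝ → E) : Prop :=
  ∀ k : ℕ, ∃ g : ℝ → E, ContDiff ℝ ∞ g ∧ ∀ x, f x = x ^ k • g x

namespace IsFlatAtZero

theorem contDiff {f : ℝ → E} (hf : IsFlatAtZero f) : ContDiff ℝ ∞ f := by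
  obtain ⟨g, hg, h⟩ := hf 0
  rwa [show f = g from funext fun x => by simp [h x]]

theorem apply_zero {f : ℝ → E} (hf : IsFlatAtZero f) : f 0 = 0 := by
  obtain ⟨g, -, h⟩ := hf 1
  simp [h 0]

theorem deriv {f : ℝ → E} (hf : IsFlatAtZero f) : IsFlatAtZero (deriv f) := by
  intro k
  obtain ⟨g, hg, h⟩ := hf (k + 1)
  refine ⟨fun x => (k + 1 : ℝ) • g x + x • _root_.deriv g x,
    (hg.const_smul _).add (contDiff_id.smul (contDiff_infty_iff_deriv.1 hg).2), fun x => ?_⟩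
  have := ((hasDerivAt_pow (k + 1) x).smul (hg.differentiable (by simp) x).hasDerivAt).deriv
  rw [funext h]
  refine this.trans ?_
  simp only [Nat.add_sub_cancel, smul_add, smul_smul, pow_succ]
  push_cast
  module

theorem exists_eq_pow_smul {f : ℝ → E} (hf : IsFlatAtZero f) (n : ℕ) :
    ∃ g : ℝ → E, IsFlatAtZero g ∧ ∀ x, f x = x ^ n • g x := by
  obtain ⟨g, hg, h⟩ := hf n
  refine ⟨g, fun k => ?_, h⟩
  obtain ⟨r, hr, h'⟩ := hf (n + k)
  refine ⟨r, hr, congrFun ?_⟩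
  refine Continuous.ext_on (dense_compl_singleton (0 : ℝ)) hg.continuous
    (by have := hr.continuous; fun_prop) fun x hx => ?_
  have hx : x ^ n ≠ 0 := pow_ne_zero n hx
  refine smul_right_injective E hx ?_
  simp only [← h x, h' x, smul_smul, pow_add]

theorem of_eventuallyEq_zero {f : ℝ → E} (hf : ContDiff ℝ ∞ f) (h0 : f =ᶠ[𝓝 0] 0) :
    IsFlatAtZero f := by
  intro k
  refine ⟨fun x => (x ^ k)⁻¹ • f x, contDiff_iff_contDiffAt.2 fun x => ?_, fun x => ?_⟩
  · rcases eq_or_ne x 0 with rfl | hx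
    · refine (contDiffAt_const (c := (0 : E))).congr_of_eventuallyEq ?_
      filter_upwards [h0] with y hy
      simp [hy]
    · exact ((contDiffAt_id.pow k).inv (pow_ne_zero k hx)).smul hf.contDiffAt
  · rcases eq_or_ne x 0 with rfl | hx
    · simp [h0.eq_of_nhds]
    · simp [smul_smul, hx]

theorem exists_hasDerivAt_comp_sqrt {f : ℝ → E} (hf : IsFlatAtZero f) :
    ∃ g : ℝ → E, IsFlatAtZero g ∧
      ∀ t, HasDerivAt (fun t => f (√t)) (g (√t)) t := by
  obtain ⟨d, hd, h⟩ := hf.deriv.exists_eq_pow_smul 1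
  refine ⟨fun x => (1 / 2 : ℝ) • d x, fun k => ?_, ?_⟩
  · obtain ⟨r, hr, h'⟩ := hd k
    exact ⟨fun x => (1 / 2 : ℝ) • r x, hr.const_smul _,
      fun x => by simp only [h', smul_comm (x ^ k)]⟩
  have hne : ∀ t : ℝ, t ≠ 0 → HasDerivAt (fun t => f (√t)) ((1 / 2 : ℝ) • d (√t)) t := by
    intro t ht
    rcases ht.lt_or_gt with ht | ht
    · rw [Real.sqrt_eq_zero_of_nonpos ht.le, hd.apply_zero, smul_zero]
      refine (hasDerivAt_const t (f 0)).congr_of_eventuallyEq ?_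
      filter_upwards [eventually_lt_nhds ht] with s hs
      rw [Real.sqrt_eq_zero_of_nonpos hs.le]
    · have := (hf.contDiff.differentiable (by simp) (√t)).hasDerivAt.scomp t
        (Real.hasDerivAt_sqrt ht.ne')
      have hs : √t ≠ 0 := (Real.sqrt_pos.2 ht).ne'
      rw [h, smul_smul, show 1 / (2 * √t) * √t ^ 1 = 1 / 2 by field_simp] at this
      exact this
  intro t
  rcases eq_or_ne t 0 with rfl | ht
  · have hfc := hf.contDiff.continuous
    have hdc := hd.contDiff.continuous
    exact hasDerivAt_of_hasDerivAt_of_ne hne (by fun_prop)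
      (Continuous.continuousAt (by fun_prop))
  · exact hne t ht

theorem contDiff_comp_sqrt {f : ℝ → E} (hf : IsFlatAtZero f) :
    ContDiff ℝ ∞ (fun t => f (√t)) := by
  refine contDiff_infty.2 fun N => ?_
  induction N generalizing f with
  | zero =>
    have := hf.contDiff.continuous
    exact contDiff_zero.2 (by fun_prop)
  | succ N ih =>
    obtain ⟨g, hg, h⟩ := hf.exists_hasDerivAt_comp_sqrt
    push_cast
    refine contDiff_succ_iff_deriv.2 ⟨fun t => (h t).differentiableAt, by simp, ?_⟩
    rw [funext fun t => (h t).deriv]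
    exact ih hg

end IsFlatAtZero

end SmoothDivision

section Borel

variable {E : Type*} [NormedAddCommGroup E] [NormedSpace ℝ E]

theorem HasCompactSupport.exists_forall_abs_iteratedDeriv_le {ψ : ℝ → ℝ}
    (hψ : ContDiff ℝ ∞ ψ) (hs : HasCompactSupport ψ) (i : ℕ) :
    ∃ C, ∀ x, |iteratedDeriv i ψ x| ≤ C := by
  obtain ⟨C, hC⟩ := (hs.iteratedFDeriv (𝕜 := ℝ) i).exists_bound_of_continuous
    (hψ.continuous_iteratedFDeriv (WithTop.coe_le_coe.2 le_top))
  exact ⟨C, fun x => by simpa [norm_iteratedFDeriv_eq_norm_iteratedDeriv] using hC x⟩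

theorem exists_forall_abs_iteratedDeriv_pow_mul_le {χ : ℝ → ℝ} (hχ : ContDiff ℝ ∞ χ)
    (hs : HasCompactSupport χ) :
    ∃ M : ℕ → ℝ, ∀ j i l, i ≤ j → l ≤ j → ∀ x,
      |iteratedDeriv i (fun y => y ^ l * χ y) x| ≤ M j := by
  choose C hC using fun l i => HasCompactSupport.exists_forall_abs_iteratedDeriv_le
    (ψ := fun y => y ^ l * χ y) ((contDiff_id.pow l).mul hχ) hs.mul_left i
  have hC0 : ∀ l i, 0 ≤ C l i := fun l i => (abs_nonneg _).trans (hC l i 0)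
  refine ⟨fun j => ∑ l ∈ Finset.range (j + 1), ∑ i ∈ Finset.range (j + 1), C l i,
    fun j i l hi hl x => (hC l i x).trans ?_⟩
  calc C l i ≤ ∑ i ∈ Finset.range (j + 1), C l i :=
        Finset.single_le_sum (fun i _ => hC0 l i) (Finset.mem_range.2 (Nat.lt_succ_of_le hi))
    _ ≤ _ := Finset.single_le_sum (f := fun l => ∑ i ∈ Finset.range (j + 1), C l i)
        (fun l _ => Finset.sum_nonneg fun i _ => hC0 l i)
        (Finset.mem_range.2 (Nat.lt_succ_of_le hl))

theorem iteratedDeriv_pow_mul_comp_mul_smul {χ : ℝ → ℝ} (hχ : ContDiff ℝ ∞ χ) {c : ℝ}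
    (hc : c ≠ 0) (j i : ℕ) (a : E) (x : ℝ) :
    iteratedDeriv i (fun x => (x ^ j * χ (c * x)) • a) x =
      ((c ^ j)⁻¹ * (c ^ i * iteratedDeriv i (fun y => y ^ j * χ y) (c * x))) • a := by
  have hψ : ContDiff ℝ ∞ fun y => y ^ j * χ y := (contDiff_id.pow j).mul hχ
  have hi : ((i : ℕ∞) : WithTop ℕ∞) ≤ ∞ := WithTop.coe_le_coe.2 le_top
  have h1 : (fun x => x ^ j * χ (c * x)) =
      fun x => (c ^ j)⁻¹ * (fun x => (fun y => y ^ j * χ y) (c * x)) x := by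
    funext x
    simp only [mul_pow]
    field_simp
  have h2 : ContDiff ℝ ∞ fun x => x ^ j * χ (c * x) :=
    (contDiff_id.pow j).mul (hχ.comp (contDiff_const.mul contDiff_id))
  rw [iteratedDeriv_smul_const (h2.of_le hi).contDiffAt, h1, iteratedDeriv_const_mul_field,
    iteratedDeriv_comp_const_mul (hψ.of_le hi)]

/-- **Borel's lemma**: every formal power series is the Taylor series of a smooth function. -/
theorem exists_contDiff_hasSmoothTaylorSeries [CompleteSpace E] (a : ℕ → E) :
    ∃ h : ℝ → E, ContDiff ℝ ∞ h ∧ HasSmoothTaylorSeries h a := by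
  let χ : ContDiffBump (0 : ℝ) := ⟨1, 2, one_pos, one_lt_two⟩
  have hχ : ContDiff ℝ ∞ χ := χ.contDiff
  obtain ⟨M, hM⟩ := exists_forall_abs_iteratedDeriv_pow_mul_le hχ χ.hasCompactSupport
  have hM0 : ∀ j, 0 ≤ M j := fun j =>
    (abs_nonneg _).trans (hM j 0 0 (Nat.zero_le _) (Nat.zero_le _) 0)
  let c : ℕ → ℝ := fun j => 1 + 2 ^ j * (M j * ‖a j‖)
  have hc1 : ∀ j, 1 ≤ c j := fun j => le_add_of_nonneg_right (by have := hM0 j; positivity)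
  have hc0 : ∀ j, 0 < c j := fun j => one_pos.trans_le (hc1 j)
  have hsmall : ∀ j, (c j)⁻¹ * (M j * ‖a j‖) ≤ (1 / 2) ^ j := fun j => by
    rw [inv_mul_le_iff₀ (hc0 j), one_div, inv_pow, ← div_eq_mul_inv, le_div_iff₀ (by positivity)]
    simp only [c]
    linarith
  let T : ℕ → ℕ → ℝ → E := fun k j x => (x ^ j * χ (c (j + k) * x)) • a (j + k)
  have hT : ∀ k j, ContDiff ℝ ∞ (T k j) := fun k j =>
    ((contDiff_id.pow j).mul (hχ.comp (contDiff_const.mul contDiff_id))).smul contDiff_const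
  have hbound : ∀ k i j, i < j → ∀ x, ‖iteratedDeriv i (T k j) x‖ ≤ (1 / 2) ^ j := by
    intro k i j hij x
    have hpow : (c (j + k) ^ j)⁻¹ * c (j + k) ^ i ≤ (c (j + k))⁻¹ := by
      rw [inv_mul_le_iff₀ (pow_pos (hc0 _) j), ← div_eq_mul_inv, le_div_iff₀ (hc0 _), ← pow_succ]
      exact pow_le_pow_right₀ (hc1 _) hij
    rw [iteratedDeriv_pow_mul_comp_mul_smul hχ (hc0 _).ne', norm_smul, ← mul_assoc,
      norm_mul, Real.norm_of_nonneg (by have := hc0 (j + k); positivity), mul_assoc]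
    calc _ ≤ (c (j + k))⁻¹ * (M (j + k) * ‖a (j + k)‖) := by
          gcongr
          · exact inv_nonneg.2 (hc0 _).le
          · exact hM _ _ _ (by omega) (by omega) _
      _ ≤ (1 / 2) ^ (j + k) := hsmall _
      _ ≤ (1 / 2) ^ j := pow_le_pow_of_le_one (by norm_num) (by norm_num) (Nat.le_add_right _ _)
  have hgeom : Summable fun j : ℕ => (1 / 2 : ℝ) ^ j := summable_geometric_two
  have hsum : ∀ k x, Summable fun j => T k j x := fun k x => by
    refine Summable.of_norm_bounded_eventually_nat hgeom ?_
    filter_upwards [eventually_gt_atTop 0] with j hj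
    simpa using hbound k 0 j hj x
  let S : ℕ → ℝ → E := fun k x => ∑' j, T k j x
  have hS : ∀ k, ContDiff ℝ ∞ (S k) := fun k => by
    refine contDiff_tsum_of_eventually (hT k) (v := fun _ j => (1 / 2 : ℝ) ^ j)
      (fun _ _ => hgeom) fun i _ => ?_
    rw [Nat.cofinite_eq_atTop]
    filter_upwards [eventually_gt_atTop i] with j hj x
    rw [norm_iteratedFDeriv_eq_norm_iteratedDeriv]
    exact hbound k i j hj x
  have hrec : ∀ k x, S k x = χ (c k * x) • a k + x • S (k + 1) x := fun k x => by
    simp only [S]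
    rw [(hsum k x).tsum_eq_zero_add, ← (hsum (k + 1) x).tsum_const_smul]
    congr 1
    · simp [T]
    · refine tsum_congr fun j => ?_
      simp only [T, smul_smul, show j + 1 + k = j + (k + 1) by ring]
      congr 1
      ring
  have hexp : ∀ k x, S 0 x =
      ∑ j ∈ Finset.range k, (x ^ j * χ (c j * x)) • a j + x ^ k • S k x := fun k x => by
    induction k with
    | zero => simp
    | succ k ih =>
      rw [ih, hrec k x, Finset.sum_range_succ, smul_add, smul_smul, smul_smul, ← pow_succ,
        add_assoc]
  have hflat : ∀ j, IsFlatAtZero fun x => χ (c j * x) - 1 := fun j => by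
    refine IsFlatAtZero.of_eventuallyEq_zero
      ((hχ.comp (contDiff_const.mul contDiff_id)).sub contDiff_const) ?_
    have ht : Tendsto (fun x => c j * x) (𝓝 0) (𝓝 0) :=
      Continuous.tendsto' (by fun_prop) _ _ (by simp)
    filter_upwards [ht.eventually χ.eventuallyEq_one] with x hx
    simp [hx]
  refine ⟨S 0, hS 0, fun k => ?_⟩
  choose u hu hu' using fun j => hflat j k
  refine ⟨fun x => ∑ j ∈ Finset.range k, (x ^ j * u j x) • a j + S k x,
    (ContDiff.sum fun j _ => ((contDiff_id.pow j).mul (hu j)).smul contDiff_const).add (hS k),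
    fun x => ?_⟩
  rw [hexp k x, smul_add, ← add_assoc, Finset.smul_sum, ← Finset.sum_add_distrib]
  congr 1
  refine Finset.sum_congr rfl fun j _ => ?_
  rw [smul_smul, ← add_smul, show χ (c j * x) = 1 + x ^ k * u j x by
    linear_combination (hu' j x : χ (c j * x) - 1 = x ^ k * u j x)]
  congr 1
  ring

end Borel

section Equivariant

theorem fderiv_apply_mul_of_apply_mul {f : ℂ → ℂ} (hf : Differentiable ℝ f) {w W : ℂ}
    (h : ∀ z, f (w * z) = W * f z) (z v : ℂ) :
    fderiv ℝ f (w * z) (w * v) = W * fderiv ℝ f z v := by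
  have h1 : HasFDerivAt (fun z => f (w * z))
      ((fderiv ℝ f (w * z)).comp (w • ContinuousLinearMap.id ℝ ℂ)) z :=
    (hf (w * z)).hasFDerivAt.comp z ((hasFDerivAt_id z).const_mul w)
  have h2 : HasFDerivAt (fun z => f (w * z)) (W • fderiv ℝ f z) z := by
    rw [funext h]
    exact (hf z).hasFDerivAt.const_mul W
  simpa using congrArg (fun L : ℂ →L[ℝ] ℂ => L v) (h1.unique h2)

/-- `f` transforms by the character `e^{imφ}` under rotations. -/
def IsRotationEquivariant (m : ℤ) (f : ℂ → ℂ) : Prop :=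
  ∀ (φ : ℝ) (z : ℂ),
    f (Complex.exp (φ * Complex.I) * z) = Complex.exp ((m : ℂ) * φ * Complex.I) * f z

namespace IsRotationEquivariant

theorem apply_zero {m : ℤ} {f : ℂ → ℂ} (hf : IsRotationEquivariant m f) (hm : m ≠ 0) :
    f 0 = 0 := by
  have h := hf (Real.pi / m) 0
  have hm' : (m : ℂ) ≠ 0 := Int.cast_ne_zero.2 hm
  push_cast at h
  rw [mul_zero, mul_div_cancel₀ _ hm', Complex.exp_pi_mul_I] at h
  linear_combination h / 2

/-- The combination `∂₁ f - ε i ∂₂ f` of partial derivatives shifts the weight by `-ε`, for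
`ε = ±1`. -/
theorem fderiv_sub {m : ℤ} {f : ℂ → ℂ} (hf : IsRotationEquivariant m f)
    (hd : Differentiable ℝ f) {ε : ℤ} (hε : ε = 1 ∨ ε = -1) :
    IsRotationEquivariant (m - ε)
      fun z => fderiv ℝ f z 1 - ε * Complex.I * fderiv ℝ f z Complex.I := by
  intro φ z
  have key : ∀ v, fderiv ℝ f (Complex.exp (φ * Complex.I) * z) (Complex.exp (φ * Complex.I) * v) =
      Complex.exp ((m : ℂ) * φ * Complex.I) * fderiv ℝ f z v :=
    fderiv_apply_mul_of_apply_mul hd (hf φ) z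
  set L := fderiv ℝ f (Complex.exp (φ * Complex.I) * z)
  have hlin : ∀ x y : ℝ, L (x + y * Complex.I) = x * L 1 + y * L Complex.I := fun x y => by
    have : (x + y * Complex.I : ℂ) = x • (1 : ℂ) + y • Complex.I := by simp
    rw [this, map_add, map_smul, map_smul]
    simp
  have hexp : Complex.exp (φ * Complex.I) = Real.cos φ + Real.sin φ * Complex.I := by
    rw [Complex.exp_mul_I, Complex.ofReal_cos, Complex.ofReal_sin]
  have h1 := key 1
  have h2 := key Complex.I
  rw [mul_one, hexp, hlin] at h1
  rw [hexp, show (Real.cos φ + Real.sin φ * Complex.I) * Complex.I =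
    ((-Real.sin φ : ℝ) : ℂ) + Real.cos φ * Complex.I by
      rw [Complex.ofReal_neg]; linear_combination (Real.sin φ : ℂ) * Complex.I_mul_I, hlin] at h2
  have hcs : (Real.cos φ : ℂ) ^ 2 + (Real.sin φ : ℂ) ^ 2 = 1 := by
    exact_mod_cast Real.cos_sq_add_sin_sq φ
  have hsplit : Complex.exp (((m - ε : ℤ) : ℂ) * φ * Complex.I) =
      Complex.exp ((m : ℂ) * φ * Complex.I) * (Real.cos φ - ε * Real.sin φ * Complex.I) := by
    have : Complex.exp (-(ε : ℂ) * φ * Complex.I) = Real.cos φ - ε * Real.sin φ * Complex.I := by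
      rcases hε with rfl | rfl
      · rw [show -((1 : ℤ) : ℂ) * φ * Complex.I = ((-φ : ℝ) : ℂ) * Complex.I by push_cast; ring,
          Complex.exp_mul_I, ← Complex.ofReal_cos, ← Complex.ofReal_sin, Real.cos_neg,
          Real.sin_neg]
        push_cast
        ring
      · rw [show -((-1 : ℤ) : ℂ) * φ * Complex.I = φ * Complex.I by push_cast; ring, hexp]
        push_cast
        ring
    rw [← this, ← Complex.exp_add]
    congr 1
    push_cast
    ring
  have hε2 : (ε : ℂ) ^ 2 * Complex.I ^ 2 = -1 := by rcases hε with rfl | rfl <;> simp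
  rw [hsplit]
  change L 1 - ε * Complex.I * L Complex.I = _
  push_cast at h1 h2 hcs ⊢
  linear_combination
    (Complex.cos φ - ε * Complex.sin φ * Complex.I) * h1
      - ε * Complex.I * (Complex.cos φ - ε * Complex.sin φ * Complex.I) * h2
      - (L 1 - ε * Complex.I * L Complex.I) * hcs
      + (L 1 * Complex.sin φ ^ 2 - L Complex.I * Complex.cos φ * Complex.sin φ) * hε2

theorem iteratedDeriv_ofReal_eq_zero {k : ℕ} {m : ℤ} {f : ℂ → ℂ} (hf : IsRotationEquivariant m f)
    (hs : ContDiff ℝ ∞ f) (hkm : (k : ℤ) < |m| ∨ Odd (m + k)) :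
    iteratedDeriv k (fun x : ℝ => f x) 0 = 0 := by
  induction k generalizing m f with
  | zero =>
    have hm : m ≠ 0 := by
      rintro rfl
      simp at hkm
    simpa using hf.apply_zero hm
  | succ k ih =>
    have hd : Differentiable ℝ f := hs.differentiable (by simp)
    have hs' : ∀ v, ContDiff ℝ ∞ fun z => fderiv ℝ f z v := fun v =>
      (hs.fderiv_right (by simp)).clm_apply contDiff_const
    let g : ℤ → ℂ → ℂ := fun ε z => fderiv ℝ f z 1 - ε * Complex.I * fderiv ℝ f z Complex.I
    have hg : ∀ ε, ContDiff ℝ ∞ (g ε) := fun ε =>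
      (hs' 1).sub (contDiff_const.mul (hs' Complex.I))
    have hgr : ∀ ε, ContDiffAt ℝ k (fun x : ℝ => g ε x) 0 := fun ε =>
      (((hg ε).comp Complex.ofRealCLM.contDiff).of_le (WithTop.coe_le_coe.2 le_top)).contDiffAt
    have hg0 : ∀ ε, (ε = 1 ∨ ε = -1) → iteratedDeriv k (fun x : ℝ => g ε x) 0 = 0 :=
      fun ε hε => by
        refine ih (hf.fderiv_sub hd hε) (hg ε) ?_
        rw [Int.odd_iff, lt_abs] at hkm ⊢
        push_cast at hkm
        rcases hε with rfl | rfl <;> omega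
    have hderiv : deriv (fun x : ℝ => f x) =
        fun x : ℝ => (1 / 2 : ℂ) * (g 1 x + g (-1) x) := by
      funext x
      have := (hd x).hasFDerivAt.comp_hasDerivAt x Complex.ofRealCLM.hasDerivAt
      refine this.deriv.trans ?_
      simp only [g, Complex.ofRealCLM_apply, Complex.ofReal_one]
      push_cast
      ring
    rw [iteratedDeriv_succ', hderiv, iteratedDeriv_const_mul_field,
      iteratedDeriv_fun_add (hgr 1) (hgr (-1)), hg0 1 (Or.inl rfl), hg0 (-1) (Or.inr rfl)]
    simp

end IsRotationEquivariant

end Equivariant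

theorem Finset.sum_range_add_two_mul_of_eq_zero {M : Type*} [AddCommMonoid M] {u : ℕ → M} {n : ℕ}
    (h : ∀ j, j < n ∨ Odd (n + j) → u j = 0) (k : ℕ) :
    ∑ j ∈ Finset.range (n + 2 * k), u j = ∑ j ∈ Finset.range k, u (n + 2 * j) := by
  induction k with
  | zero => exact Finset.sum_eq_zero fun j hj => h j (Or.inl (Finset.mem_range.1 hj))
  | succ k ih =>
    rw [show n + 2 * (k + 1) = n + 2 * k + 1 + 1 by ring, Finset.sum_range_succ,
      Finset.sum_range_succ, ih, Finset.sum_range_succ,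
      h (n + 2 * k + 1) (Or.inr ⟨n + k, by ring⟩), add_zero]

/-- A smooth function whose Taylor series at `0` only involves the monomials `x ^ (n + 2 * j)` is
`x ^ n` times a smooth function of `x ^ 2`, for `0 ≤ x`. -/
theorem ContDiff.exists_eq_pow_smul_comp_sq {E : Type*} [NormedAddCommGroup E] [NormedSpace ℝ E]
    [CompleteSpace E] {F : ℝ → E} (hF : ContDiff ℝ ∞ F) {n : ℕ}
    (h : ∀ j, j < n ∨ Odd (n + j) → iteratedDeriv j F 0 = 0) :
    ∃ g : ℝ → E, ContDiff ℝ ∞ g ∧ ∀ x, 0 ≤ x → F x = x ^ n • g (x ^ 2) := by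
  set a : ℕ → E := fun j => (j.factorial : ℝ)⁻¹ • iteratedDeriv j F 0 with ha
  obtain ⟨p, hp, hpT⟩ := exists_contDiff_hasSmoothTaylorSeries fun j => a (n + 2 * j)
  have hflat : IsFlatAtZero fun x => F x - x ^ n • p (x ^ 2) := by
    intro k
    obtain ⟨r, hr, hFr⟩ := hF.hasSmoothTaylorSeries (n + 2 * k)
    obtain ⟨s, hs, hps⟩ := hpT k
    refine ⟨fun x => x ^ (n + k) • (r x - s (x ^ 2)),
      (contDiff_id.pow _).smul (hr.sub (hs.comp (contDiff_id.pow 2))), fun x => ?_⟩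
    have hsum := Finset.sum_range_add_two_mul_of_eq_zero (u := fun j => x ^ j • a j) (n := n)
      (fun j hj => by simp [ha, h j hj]) k
    simp only
    rw [hFr x, hps, hsum, smul_add, Finset.smul_sum]
    simp only [smul_smul, ← pow_mul, ← pow_add, smul_sub]
    rw [show k + (n + k) = n + 2 * k by ring]
    abel
  obtain ⟨e, he, hFe⟩ := hflat.exists_eq_pow_smul n
  refine ⟨fun t => p t + e (√t), hp.add he.contDiff_comp_sqrt, fun x hx => ?_⟩
  simp only
  rw [Real.sqrt_sq hx, smul_add, ← hFe x]
  abel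

/-- A smooth function `f : ℂ → ℂ` with `f(e^{iφ} z) = e^{inφ} f(z)` (for `n ≥ 0`) has the
form `f(r e^{iφ}) = e^{inφ} r^n h(r²)` with `h` a smooth function of `a = r²`
(extending smoothly to `a = 0`). -/
theorem stmt8 (f : ℂ → ℂ) (hf : ContDiff ℝ (⊤ : ℕ∞) f) (n : ℕ)
    (hequiv : ∀ (φ : ℝ) (z : ℂ),
      f (Complex.exp (φ * Complex.I) * z) = Complex.exp ((n : ℂ) * φ * Complex.I) * f z) :
    ∃ h : ℝ → ℂ, ContDiff ℝ (⊤ : ℕ∞) h ∧ ∀ (r : ℝ), 0 ≤ r → ∀ φ : ℝ,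
      f ((r : ℂ) * Complex.exp (φ * Complex.I))
        = Complex.exp ((n : ℂ) * φ * Complex.I) * (r : ℂ) ^ n * h (r ^ 2) := by
  have hf' : IsRotationEquivariant n f := fun φ z => by simpa using hequiv φ z
  obtain ⟨h, hh, hFh⟩ := (hf.comp Complex.ofRealCLM.contDiff).exists_eq_pow_smul_comp_sq (n := n)
    fun j hj => hf'.iteratedDeriv_ofReal_eq_zero hf
      (hj.imp (fun hj => by simpa using hj) (fun hj => by exact_mod_cast hj))
  refine ⟨h, hh, fun r hr φ => ?_⟩
  have hr' : f r = (r : ℂ) ^ n * h (r ^ 2) := by simpa using hFh r hr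
  rw [mul_comm, hequiv, hr', mul_assoc (Complex.exp _)]
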